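/- arXiv:1907.08766 — 4 statements merged into one kernel-verified Lean document; each statement's English description precedes it below -/
import Mathlib

section
/- Let 0 < λ ≤ 1. There exists a Borel probability measure μ on ℝ concentrated on [0, ∞) (the positive stable distribution with parameter λ) such that for every t ≥ 0, ∫ exp(−t·x) dμ(x) = exp(−t^λ). -/
open MeasureTheory ProbabilityTheory Real

noncomputable section

/-- A nonnegative random variable `Z` is *positive stable* with parameter `l` (w.r.t. the
probability measure `μ`) if its Laplace transform is `t ↦ exp (-t ^ l)`. -/
def IsPosStable {Ω : Type*} [MeasurableSpace Ω] (μ : Measure Ω) (Z : Ω → ℝ) (l : ℝ) : Prop :=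
  Measurable Z ∧ (∀ ω, 0 ≤ Z ω) ∧
    ∀ t : ℝ, 0 ≤ t → ∫ ω, Real.exp (-t * Z ω) ∂μ = Real.exp (-t ^ l)

/-- A random variable `ε` is *standard Gumbel* distributed if its cdf is `x ↦ exp (-exp (-x))`. -/
def IsStdGumbel {Ω : Type*} [MeasurableSpace Ω] (μ : Measure Ω) (ε : Ω → ℝ) : Prop :=
  Measurable ε ∧ ∀ x : ℝ, μ {ω | ε ω ≤ x} = ENNReal.ofReal (Real.exp (-Real.exp (-x)))

open Filter Topology
open scoped NNReal ENNReal

/-- Laplace transform of a measure on `ℝ≥0`. -/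
def laplaceTransform (μ : Measure ℝ≥0) (t : ℝ) : ℝ :=
  ∫ x : ℝ≥0, Real.exp (-t * x) ∂μ

theorem Ring.choose_succ_mul (l : ℝ) (n : ℕ) :
    Ring.choose l (n + 1) * (n + 1) = Ring.choose l n * (l - n) := by
  have hn : (n.factorial : ℝ) ≠ 0 := by positivity
  have hn1 : (n : ℝ) + 1 ≠ 0 := by positivity
  rw [Ring.choose_eq_smul, Ring.choose_eq_smul, descPochhammer_succ_right,
    Polynomial.smeval_mul, Nat.factorial_succ]
  simp only [Polynomial.smeval_sub, Polynomial.smeval_X, Polynomial.smeval_natCast, smul_eq_mul]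
  push_cast
  field_simp
  simp

/-- The mass at `k + 1` of the Sibuya distribution with parameter `l`. -/
def sibuyaMass (l : ℝ) (k : ℕ) : ℝ := (-1) ^ k * Ring.choose l (k + 1)

theorem sibuyaMass_nonneg {l : ℝ} (hl0 : 0 < l) (hl1 : l ≤ 1) (k : ℕ) : 0 ≤ sibuyaMass l k := by
  induction k with
  | zero => simpa [sibuyaMass, Ring.choose_one_right] using hl0.le
  | succ k ih =>
    have h := Ring.choose_succ_mul l (k + 1)
    have hrec : sibuyaMass l (k + 1) * (k + 2) = sibuyaMass l k * (k + 1 - l) := by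
      unfold sibuyaMass
      push_cast at h
      rw [pow_succ]
      linear_combination (-(-1) ^ k) * h
    have hk : (0 : ℝ) ≤ k := k.cast_nonneg
    have : 0 ≤ sibuyaMass l (k + 1) * (k + 2) := hrec ▸ mul_nonneg ih (by linarith)
    exact nonneg_of_mul_nonneg_left this (by positivity)

theorem hasSum_sibuyaMass_mul_pow (l : ℝ) {s : ℝ} (hs0 : 0 ≤ s) (hs1 : s < 1) :
    HasSum (fun k ↦ sibuyaMass l k * s ^ (k + 1)) (1 - (1 - s) ^ l) := by
  have h := (Real.one_add_rpow_hasFPowerSeriesOnBall_zero (a := l)).hasSum (y := -s) (by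
    rw [← ENNReal.ofReal_one, Metric.eball_ofReal]
    simpa [abs_of_nonneg hs0] using hs1)
  simp only [binomialSeries_apply, List.ofFn_const, List.prod_replicate, smul_eq_mul, zero_add] at h
  rw [← hasSum_nat_add_iff' 1] at h
  convert! h.neg using 1
  · ext k
    rw [sibuyaMass, neg_pow s]
    ring
  · simp [sub_eq_add_neg]

theorem hasSum_sibuyaMass {l : ℝ} (hl0 : 0 < l) (hl1 : l ≤ 1) : HasSum (sibuyaMass l) 1 := by
  have hp := sibuyaMass_nonneg hl0 hl1
  have hpart (n : ℕ) : ∑ k ∈ Finset.range n, sibuyaMass l k ≤ 1 := by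
    have hc : Tendsto (fun s : ℝ ↦ ∑ k ∈ Finset.range n, sibuyaMass l k * s ^ (k + 1)) (𝓝[<] 1)
        (𝓝 (∑ k ∈ Finset.range n, sibuyaMass l k * 1 ^ (k + 1))) :=
      ((by fun_prop : Continuous fun s : ℝ ↦
        ∑ k ∈ Finset.range n, sibuyaMass l k * s ^ (k + 1)).tendsto 1).mono_left nhdsWithin_le_nhds
    simp only [one_pow, mul_one] at hc
    refine le_of_tendsto hc ?_
    filter_upwards [Ioo_mem_nhdsLT (zero_lt_one' ℝ)] with s hs
    have h := sum_le_hasSum (Finset.range n)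
      (fun k _ ↦ mul_nonneg (hp k) (pow_nonneg hs.1.le (k + 1)))
      (hasSum_sibuyaMass_mul_pow l hs.1.le hs.2)
    have := Real.rpow_nonneg (sub_nonneg.2 hs.2.le) l
    linarith
  have hsum : Summable (sibuyaMass l) := summable_of_sum_range_le hp hpart
  have hle : ∑' k, sibuyaMass l k ≤ 1 := hsum.tsum_le_of_sum_range_le hpart
  have hge : 1 ≤ ∑' k, sibuyaMass l k := by
    have hc : Tendsto (fun s : ℝ ↦ 1 - (1 - s) ^ l) (𝓝[<] 1) (𝓝 (1 - (1 - 1) ^ l)) :=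
      ((by fun_prop (disch := exact hl0.le) : Continuous fun s : ℝ ↦
        1 - (1 - s) ^ l).tendsto 1).mono_left nhdsWithin_le_nhds
    rw [sub_self, Real.zero_rpow hl0.ne', sub_zero] at hc
    refine le_of_tendsto hc ?_
    filter_upwards [Ioo_mem_nhdsLT (zero_lt_one' ℝ)] with s hs
    refine hasSum_le (fun k ↦ ?_) (hasSum_sibuyaMass_mul_pow l hs.1.le hs.2) hsum.hasSum
    exact mul_le_of_le_one_right (hp k) (pow_le_one₀ hs.1.le hs.2.le)
  exact le_antisymm hle hge ▸ hsum.hasSum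

theorem exists_sibuya {l : ℝ} (hl0 : 0 < l) (hl1 : l ≤ 1) :
    ∃ ν : Measure ℝ≥0, IsProbabilityMeasure ν ∧
      ∀ t : ℝ, 0 ≤ t → laplaceTransform ν t = 1 - (1 - Real.exp (-t)) ^ l := by
  have hp := sibuyaMass_nonneg hl0 hl1
  have h1 := hasSum_sibuyaMass hl0 hl1
  let ν : Measure ℝ≥0 := Measure.sum fun k : ℕ ↦
    ENNReal.ofReal (sibuyaMass l k) • Measure.dirac ((k : ℝ≥0) + 1)
  have hν : IsProbabilityMeasure ν := ⟨by
    simp only [ν, Measure.sum_apply _ MeasurableSet.univ, Measure.smul_apply, measure_univ,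
      smul_eq_mul, mul_one]
    rw [← ENNReal.ofReal_tsum_of_nonneg hp h1.summable, h1.tsum_eq, ENNReal.ofReal_one]⟩
  refine ⟨ν, hν, fun t ht ↦ ?_⟩
  have hint : Integrable (fun x : ℝ≥0 ↦ Real.exp (-t * x)) ν :=
    .of_bound (C := 1) (by fun_prop) (.of_forall fun x ↦ by
      rw [Real.norm_of_nonneg (Real.exp_nonneg _), Real.exp_le_one_iff]
      nlinarith [x.coe_nonneg])
  have h := hasSum_integral_measure hint
  simp only [integral_smul_measure, integral_dirac, ENNReal.toReal_ofReal (hp _)] at h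
  refine h.unique ?_
  rcases ht.eq_or_lt with rfl | ht
  · simpa [Real.zero_rpow hl0.ne'] using h1
  · convert! hasSum_sibuyaMass_mul_pow l (Real.exp_nonneg (-t)) (by simpa using ht) using 2 with k
    rw [← Real.exp_nat_mul, smul_eq_mul]
    push_cast
    ring_nf

/-- Laplace transform of a rescaled sum of i.i.d. variables. -/
theorem exists_laplaceTransform_eq_pow (ν : Measure ℝ≥0) [IsProbabilityMeasure ν] (n : ℕ)
    (a : ℝ≥0) :
    ∃ μ : ProbabilityMeasure ℝ≥0, ∀ t : ℝ,
      laplaceTransform μ t = laplaceTransform ν (t * a) ^ n := by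
  have hm : Measurable fun x : Fin n → ℝ≥0 ↦ a * ∑ i, x i := by fun_prop
  refine ⟨⟨(Measure.pi fun _ : Fin n ↦ ν).map fun x ↦ a * ∑ i, x i,
    Measure.isProbabilityMeasure_map hm.aemeasurable⟩, fun t ↦ ?_⟩
  have h := integral_fintype_prod_eq_pow (ι := Fin n) (μ := ν)
    fun x : ℝ≥0 ↦ Real.exp (-(t * a) * x)
  rw [Fintype.card_fin] at h
  rw [laplaceTransform, laplaceTransform, ← h, ProbabilityMeasure.coe_mk,
    integral_map hm.aemeasurable (by fun_prop)]
  congr 1 with x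
  rw [← Real.exp_sum, ← Finset.mul_sum]
  push_cast
  ring_nf

/-- Tail bound in terms of the Laplace transform near zero. -/
theorem measureReal_compl_Icc_le (μ : Measure ℝ≥0) [IsProbabilityMeasure μ] {K : ℝ≥0}
    (hK : 0 < K) : μ.real (Set.Icc 0 K)ᶜ ≤ 2 * (1 - laplaceTransform μ (K : ℝ)⁻¹) := by
  have hK' : (0 : ℝ) < K := hK
  have hexp (x : ℝ≥0) : Real.exp (-(K : ℝ)⁻¹ * x) ≤ 1 := by
    rw [Real.exp_le_one_iff, neg_mul, neg_nonpos]
    positivity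
  have hint : Integrable (fun x : ℝ≥0 ↦ Real.exp (-(K : ℝ)⁻¹ * x)) μ :=
    .of_bound (C := 1) (by fun_prop) (.of_forall fun x ↦ by
      rw [Real.norm_of_nonneg (Real.exp_nonneg _)]
      exact hexp x)
  have hmarkov := mul_meas_ge_le_integral_of_nonneg
    (.of_forall fun x ↦ sub_nonneg.2 (hexp x)) ((integrable_const (1 : ℝ)).sub hint) (1 / 2)
  rw [integral_sub (integrable_const _) hint] at hmarkov
  simp only [integral_const, probReal_univ, smul_eq_mul, mul_one] at hmarkov
  have hsub : μ.real (Set.Icc 0 K)ᶜ ≤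
      μ.real {x : ℝ≥0 | 1 / 2 ≤ 1 - Real.exp (-(K : ℝ)⁻¹ * x)} := by
    refine measureReal_mono fun x hx ↦ ?_
    have hx : (K : ℝ) < x := by simpa using hx
    have h1 : Real.exp (-(K : ℝ)⁻¹ * x) ≤ Real.exp (-1) := by
      rw [Real.exp_le_exp, neg_mul, neg_le_neg_iff, inv_mul_eq_div, one_le_div hK']
      exact hx.le
    have := Real.exp_neg_one_lt_half
    simp only [Set.mem_ofPred_eq]
    linarith
  rw [laplaceTransform]
  linarith

/-- A continuity theorem for Laplace transforms, with a Hölder bound at zero giving tightness. -/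
theorem exists_laplaceTransform_eq_of_tendsto {l : ℝ} (hl0 : 0 < l) {φ : ℝ → ℝ}
    (μ : ℕ → ProbabilityMeasure ℝ≥0)
    (hbound : ∀ n, ∀ t : ℝ, 0 ≤ t → 1 - t ^ l ≤ laplaceTransform (μ n) t)
    (hlim : ∀ t : ℝ, 0 ≤ t → Tendsto (fun n ↦ laplaceTransform (μ n) t) atTop (𝓝 (φ t))) :
    ∃ ρ : ProbabilityMeasure ℝ≥0, ∀ t : ℝ, 0 ≤ t → laplaceTransform ρ t = φ t := by
  let K (n : ℕ) : ℝ≥0 := n + 1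
  let u (n : ℕ) : ℝ≥0 := 2 * (K n)⁻¹ ^ l
  have hu : Tendsto u atTop (𝓝 0) := by
    have h1 : Tendsto (fun n : ℕ ↦ (K n)⁻¹) atTop (𝓝 0) := by
      rw [← NNReal.tendsto_coe]
      simpa [K] using tendsto_one_div_add_atTop_nhds_zero_nat (𝕜 := ℝ)
    have h2 := (h1.nnrpow (tendsto_const_nhds (x := l)) (Or.inr hl0)).const_mul 2
    rwa [NNReal.zero_rpow hl0.ne', mul_zero] at h2
  have hcomp := isCompact_setOfPred_probabilityMeasure_mass_eq_compl_isCompact_le hu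
    (K := fun n ↦ Set.Icc 0 (K n)) (fun n ↦ isCompact_Icc) (Or.inl inferInstance)
  have hmem (m : ℕ) : μ m ∈ {ρ : ProbabilityMeasure ℝ≥0 | ∀ n, ρ (Set.Icc 0 (K n))ᶜ ≤ u n} := by
    intro n
    have hK : 0 < K n := by positivity
    have h := measureReal_compl_Icc_le (μ m : Measure ℝ≥0) hK
    have hb := hbound m (K n : ℝ)⁻¹ (by positivity)
    rw [← NNReal.coe_le_coe]
    calc ((μ m (Set.Icc 0 (K n))ᶜ : ℝ≥0) : ℝ)
        = (μ m : Measure ℝ≥0).real (Set.Icc 0 (K n))ᶜ := rfl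
      _ ≤ 2 * ((K n : ℝ)⁻¹) ^ l := by linarith
      _ = u n := by simp [u]
  obtain ⟨ρ, -, hρ⟩ := hcomp.ultrafilter_le_nhds ((hyperfilter ℕ).map μ)
    (tendsto_principal.2 (.of_forall hmem))
  refine ⟨ρ, fun t ht ↦ ?_⟩
  have hρ' : Tendsto μ (hyperfilter ℕ : Filter ℕ) (𝓝 ρ) := hρ
  rw [ProbabilityMeasure.tendsto_iff_forall_integral_tendsto] at hρ'
  let f : BoundedContinuousFunction ℝ≥0 ℝ :=
    .ofNormedAddCommGroup (fun x : ℝ≥0 ↦ Real.exp (-t * x)) (by fun_prop) 1 fun x ↦ by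
      rw [Real.norm_of_nonneg (Real.exp_nonneg _), Real.exp_le_one_iff]
      nlinarith [x.coe_nonneg]
  exact tendsto_nhds_unique (hρ' f) ((hlim t ht).mono_left Nat.hyperfilter_le_atTop)

theorem natCast_mul_mul_rpow {l : ℝ} (hl0 : 0 < l) {y : ℝ} (hy : 0 ≤ y) (n : ℕ) :
    (n : ℝ) * y ^ l = ((n : ℝ) ^ l⁻¹ * y) ^ l := by
  rw [Real.mul_rpow (by positivity) hy, Real.rpow_inv_rpow n.cast_nonneg hl0.ne']

theorem tendsto_mul_one_sub_exp (t : ℝ) :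
    Tendsto (fun x : ℝ ↦ x * (1 - Real.exp (-(t * x⁻¹)))) atTop (𝓝 t) := by
  have hd : HasDerivAt (fun u : ℝ ↦ 1 - Real.exp (-(t * u))) t 0 := by
    convert! (((hasDerivAt_id (0 : ℝ)).const_mul t).neg.exp).const_sub 1 using 1
    simp
  have h := hd.tendsto_slope_zero_right.comp tendsto_inv_atTop_nhdsGT_zero
  simpa [Function.comp_def] using h

/-- Existence of the positive stable distribution with parameter `l ∈ (0, 1]`: a Borel
probability measure on `ℝ` concentrated on `[0, ∞)` with Laplace transform `t ↦ exp (-t ^ l)`. -/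
theorem stmt_0 (l : ℝ) (hl0 : 0 < l) (hl1 : l ≤ 1) :
    ∃ μ : Measure ℝ, IsProbabilityMeasure μ ∧ μ (Set.Iio 0) = 0 ∧
      ∀ t : ℝ, 0 ≤ t → ∫ x, Real.exp (-t * x) ∂μ = Real.exp (-t ^ l) := by
  obtain ⟨ν, hν, hLν⟩ := exists_sibuya hl0 hl1
  choose μ hμ using fun n : ℕ ↦ exists_laplaceTransform_eq_pow ν n ((n : ℝ≥0) ^ l⁻¹)⁻¹
  have hLμ (n : ℕ) {t : ℝ} (ht : 0 ≤ t) : laplaceTransform (μ n) t =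
      (1 + -(1 - Real.exp (-(t * ((n : ℝ) ^ l⁻¹)⁻¹))) ^ l) ^ n := by
    rw [hμ, hLν _ (by positivity), ← sub_eq_add_neg]
    simp
  have hnonneg (n : ℕ) {t : ℝ} (ht : 0 ≤ t) :
      0 ≤ 1 - Real.exp (-(t * ((n : ℝ) ^ l⁻¹)⁻¹)) := by
    rw [sub_nonneg, Real.exp_le_one_iff, neg_nonpos]
    positivity
  obtain ⟨ρ, hρ⟩ := exists_laplaceTransform_eq_of_tendsto (φ := fun t ↦ Real.exp (-t ^ l)) hl0 μ
    (fun n t ht ↦ by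
      have h0 := hnonneg n ht
      have h1 : (1 - Real.exp (-(t * ((n : ℝ) ^ l⁻¹)⁻¹))) ^ l ≤ 1 :=
        Real.rpow_le_one h0 (by linarith [Real.exp_nonneg (-(t * ((n : ℝ) ^ l⁻¹)⁻¹))]) hl0.le
      have h2 : (n : ℝ) * (1 - Real.exp (-(t * ((n : ℝ) ^ l⁻¹)⁻¹))) ^ l ≤ t ^ l := by
        rw [natCast_mul_mul_rpow hl0 h0]
        refine Real.rpow_le_rpow (by positivity) ?_ hl0.le
        have h3 := Real.one_sub_le_exp_neg (t * ((n : ℝ) ^ l⁻¹)⁻¹)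
        calc (n : ℝ) ^ l⁻¹ * (1 - Real.exp (-(t * ((n : ℝ) ^ l⁻¹)⁻¹)))
            ≤ (n : ℝ) ^ l⁻¹ * (t * ((n : ℝ) ^ l⁻¹)⁻¹) := by
              gcongr
              linarith
          _ = t * ((n : ℝ) ^ l⁻¹ * ((n : ℝ) ^ l⁻¹)⁻¹) := by ring
          _ ≤ t := mul_le_of_le_one_right ht mul_inv_le_one
      rw [hLμ n ht]
      refine le_trans ?_ (one_add_mul_le_pow (by linarith) n)
      linarith)
    (fun t ht ↦ by
      refine (Real.tendsto_one_add_pow_exp_of_tendsto ?_).congr fun n ↦ (hLμ n ht).symm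
      have hx : Tendsto (fun n : ℕ ↦ (n : ℝ) ^ l⁻¹) atTop atTop :=
        (tendsto_rpow_atTop (inv_pos.2 hl0)).comp tendsto_natCast_atTop_atTop
      refine ((((tendsto_mul_one_sub_exp t).comp hx).rpow_const (Or.inr hl0.le)).neg).congr
        fun n ↦ ?_
      rw [mul_neg, natCast_mul_mul_rpow hl0 (hnonneg n ht)]
      rfl)
  refine ⟨(ρ : Measure ℝ≥0).map (↑), Measure.isProbabilityMeasure_map (by fun_prop), ?_,
    fun t ht ↦ ?_⟩
  · rw [Measure.map_apply (by fun_prop) measurableSet_Iio]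
    convert measure_empty (μ := (ρ : Measure ℝ≥0))
    ext x
    simp
  · rw [integral_map (by fun_prop) (by fun_prop)]
    exact hρ t ht
end
end

section
/- Let 0 < λ ≤ 1 and let Z be a nonnegative random variable that is positive stable with parameter λ (note Z > 0 almost surely). Then the random variable η = λ·log Z is integrable and E[η] = (1 − λ)·γ, where γ is the Euler–Mascheroni constant. -/
open MeasureTheory ProbabilityTheory Real

noncomputable section

section

open Filter Set Topology

/-- For fixed `x`, the difference quotients at `0` of `s ↦ exp (s * x)` increase with `s`. -/
lemma slope_exp_mul_mono {s t : ℝ} (x : ℝ) (hs : 0 < s) (hst : s ≤ t) :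
    slope (fun u => Real.exp (u * x)) 0 s ≤ slope (fun u => Real.exp (u * x)) 0 t := by
  have hconv : ConvexOn ℝ univ (fun u : ℝ => Real.exp (u * x)) := by
    simpa [Function.comp_def, LinearMap.mulRight_apply] using
      convexOn_exp.comp_linearMap (LinearMap.mulRight ℝ x)
  simpa only [slope_def_field] using hconv.secant_mono (mem_univ 0) (mem_univ s) (mem_univ t)
    hs.ne' (hs.trans_le hst).ne' hst

/-- If the moment generating function of `X` is finite on `(0, 1]` and has a right derivative `d`
at `0`, then `X` is integrable with mean `d`. -/
lemma integrable_and_integral_eq_of_hasDerivWithinAt_mgf {Ω : Type*} [MeasurableSpace Ω]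
    {μ : Measure Ω} [IsProbabilityMeasure μ] {X : Ω → ℝ} {d : ℝ}
    (hint : ∀ s, 0 < s → s ≤ 1 → Integrable (fun ω => Real.exp (s * X ω)) μ)
    (hd : HasDerivWithinAt (mgf X μ) d (Ioi 0) 0) :
    Integrable X μ ∧ ∫ ω, X ω ∂μ = d := by
  set s : ℕ → ℝ := fun n => 1 / ((n : ℝ) + 1) with hs
  have hs0 (n : ℕ) : 0 < s n := Nat.one_div_pos_of_nat
  have hs1 (n : ℕ) : s n ≤ 1 := by
    simpa [hs] using Nat.one_div_le_one_div (α := ℝ) (Nat.zero_le n)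
  have hsanti : Antitone s := fun m n hmn => Nat.one_div_le_one_div hmn
  have hslim : Tendsto s atTop (𝓝[>] 0) :=
    tendsto_nhdsWithin_iff.2 ⟨tendsto_one_div_add_atTop_nhds_zero_nat, .of_forall hs0⟩
  set F : ℕ → Ω → ℝ := fun n ω => slope (fun u => Real.exp (u * X ω)) 0 (s n) with hF
  set G : ℕ → Ω → ℝ := fun n ω => (Real.exp (1 * X ω) - 1) - F n ω with hG
  have hFint (n : ℕ) : Integrable (F n) μ := by
    simp only [hF, slope_def_field, zero_mul, Real.exp_zero, sub_zero]
    exact ((hint _ (hs0 n) (hs1 n)).sub (integrable_const 1)).div_const _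
  have hone : Integrable (fun ω => Real.exp (1 * X ω) - 1) μ :=
    (hint 1 one_pos le_rfl).sub (integrable_const 1)
  have hFval (n : ℕ) : ∫ ω, F n ω ∂μ = slope (mgf X μ) 0 (s n) := by
    simp only [hF, slope_def_field, zero_mul, Real.exp_zero, sub_zero, mgf_zero]
    rw [integral_div, integral_sub (hint _ (hs0 n) (hs1 n)) (integrable_const 1)]
    simp [mgf]
  have hGint (n : ℕ) : Integrable (G n) μ := hone.sub (hFint n)
  have hGnonneg (n : ℕ) (ω : Ω) : 0 ≤ G n ω := by
    have := slope_exp_mul_mono (X ω) (hs0 n) (hs1 n)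
    simp only [slope_def_field (b := (1 : ℝ)), zero_mul, Real.exp_zero, sub_zero, div_one] at this
    exact sub_nonneg.2 this
  have hGmono (ω : Ω) : Monotone fun n => G n ω := fun m n hmn =>
    sub_le_sub_left (slope_exp_mul_mono (X ω) (hs0 n) (hsanti hmn)) _
  have hGlim (ω : Ω) :
      Tendsto (fun n => G n ω) atTop (𝓝 ((Real.exp (1 * X ω) - 1) - X ω)) := by
    have hder : HasDerivAt (fun u : ℝ => Real.exp (u * X ω)) (X ω) 0 := by
      simpa using ((hasDerivAt_id (0 : ℝ)).mul_const (X ω)).exp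
    exact tendsto_const_nhds.sub
      (((hasDerivWithinAt_iff_tendsto_slope' self_notMem_Ioi).1 hder.hasDerivWithinAt).comp hslim)
  set c : ℝ := ∫ ω, (Real.exp (1 * X ω) - 1) ∂μ - d with hc
  have hGval : Tendsto (fun n => ∫ ω, G n ω ∂μ) atTop (𝓝 c) := by
    have := ((hasDerivWithinAt_iff_tendsto_slope' self_notMem_Ioi).1 hd).comp hslim
    refine (tendsto_const_nhds.sub this).congr fun n => ?_
    rw [integral_sub hone (hFint n), hFval n, Function.comp_apply]
  have hc0 : 0 ≤ c := ge_of_tendsto' hGval fun n => integral_nonneg (hGnonneg n)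
  have hlint : ∫⁻ ω, ENNReal.ofReal ((Real.exp (1 * X ω) - 1) - X ω) ∂μ = ENNReal.ofReal c := by
    refine tendsto_nhds_unique (lintegral_tendsto_of_tendsto_of_monotone
      (f := fun n ω => ENNReal.ofReal (G n ω))
      (fun n => (hGint n).aestronglyMeasurable.aemeasurable.ennreal_ofReal)
      (.of_forall fun ω m n hmn => ENNReal.ofReal_le_ofReal (hGmono ω hmn))
      (.of_forall fun ω => ENNReal.tendsto_ofReal (hGlim ω))) ?_
    refine (ENNReal.tendsto_ofReal hGval).congr fun n => ?_
    exact ofReal_integral_eq_lintegral_ofReal (hGint n) (.of_forall (hGnonneg n))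
  have hmeas : AEStronglyMeasurable (fun ω => (Real.exp (1 * X ω) - 1) - X ω) μ :=
    aestronglyMeasurable_of_tendsto_ae atTop (fun n => (hGint n).aestronglyMeasurable)
      (.of_forall hGlim)
  have hnonneg : 0 ≤ᵐ[μ] fun ω => (Real.exp (1 * X ω) - 1) - X ω :=
    .of_forall fun ω => ge_of_tendsto' (hGlim ω) fun n => hGnonneg n ω
  have hint' : Integrable (fun ω => (Real.exp (1 * X ω) - 1) - X ω) μ :=
    (lintegral_ofReal_ne_top_iff_integrable hmeas hnonneg).1 (hlint ▸ ENNReal.ofReal_ne_top)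
  have hval : ∫ ω, ((Real.exp (1 * X ω) - 1) - X ω) ∂μ = c := by
    rw [integral_eq_lintegral_of_nonneg_ae hnonneg hmeas, hlint, ENNReal.toReal_ofReal hc0]
  have hX : Integrable X μ := by simpa [Pi.sub_def] using hone.sub hint'
  refine ⟨hX, ?_⟩
  rw [integral_sub hone hX, hc] at hval
  linarith

namespace IsPosStable

variable {Ω : Type*} [MeasurableSpace Ω] {μ : Measure Ω} {Z : Ω → ℝ} {l : ℝ}

lemma integrable_exp_neg_mul (hZ : IsPosStable μ Z l) {t : ℝ} (ht : 0 ≤ t) :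
    Integrable (fun ω => Real.exp (-t * Z ω)) μ := by
  refine .of_integral_ne_zero ?_
  rw [hZ.2.2 t ht]
  exact (Real.exp_pos _).ne'

variable [IsProbabilityMeasure μ]

lemma ae_pos (hl : 0 < l) (hZ : IsPosStable μ Z l) : ∀ᵐ ω ∂μ, 0 < Z ω := by
  have hms : MeasurableSet {ω | Z ω = 0} := hZ.1 (measurableSet_singleton 0)
  have hle (t : ℝ) (ht : 0 ≤ t) : μ.real {ω | Z ω = 0} ≤ Real.exp (-t ^ l) := by
    rw [← hZ.2.2 t ht, ← integral_indicator_one hms]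
    refine integral_mono ((integrable_const 1).indicator hms) (hZ.integrable_exp_neg_mul ht)
      (indicator_le' (fun ω hω => ?_) (fun ω _ => (Real.exp_pos _).le))
    rw [show Z ω = 0 from hω]
    simp
  have hlim : Tendsto (fun t : ℝ => Real.exp (-t ^ l)) atTop (𝓝 0) :=
    Real.tendsto_exp_neg_atTop_nhds_zero.comp (tendsto_rpow_atTop hl)
  have hzero : μ.real {ω | Z ω = 0} = 0 :=
    le_antisymm (ge_of_tendsto hlim ((eventually_ge_atTop 0).mono hle)) measureReal_nonneg
  have hnull : μ {ω | Z ω = 0} = 0 := (measureReal_eq_zero_iff).1 hzero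
  have hne : ∀ᵐ ω ∂μ, Z ω ≠ 0 := by simpa [ae_iff] using hnull
  filter_upwards [hne] with ω hω using (hZ.2.1 ω).lt_of_ne' hω

/-- Fubini applied to the Gamma integral of `Z ω ^ (-s)`. -/
lemma integrable_and_integral_rpow_neg (hl : 0 < l) (hZ : IsPosStable μ Z l) {s : ℝ}
    (hs : 0 < s) :
    Integrable (fun ω => Z ω ^ (-s)) μ ∧
      ∫ ω, Z ω ^ (-s) ∂μ = Real.Gamma (1 + s / l) / Real.Gamma (1 + s) := by
  have hΓ : Real.Gamma s ≠ 0 := (Real.Gamma_pos_of_pos hs).ne'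
  set f : Ω → ℝ → ℝ := fun ω t => t ^ (s - 1) * Real.exp (-t * Z ω) with hf
  have hmeas : Measurable (Function.uncurry f) :=
    (measurable_snd.pow_const (s - 1)).mul (measurable_snd.neg.mul (hZ.1.comp measurable_fst)).exp
  have hinner (t : ℝ) (ht : t ∈ Ioi (0 : ℝ)) :
      ∫ ω, f ω t ∂μ = t ^ (s - 1) * Real.exp (-t ^ l) := by
    rw [integral_const_mul, hZ.2.2 t (mem_Ioi.1 ht).le]
  have hprod : Integrable (Function.uncurry f) (μ.prod (volume.restrict (Ioi 0))) := by
    refine (integrable_prod_iff' hmeas.aestronglyMeasurable).2 ⟨?_, ?_⟩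
    · filter_upwards [ae_restrict_mem measurableSet_Ioi] with t ht
      exact (hZ.integrable_exp_neg_mul (mem_Ioi.1 ht).le).const_mul (t ^ (s - 1))
    · refine IntegrableOn.congr_fun (f := fun t : ℝ => t ^ (s - 1) * Real.exp (-t ^ l))
        (integrableOn_rpow_mul_exp_neg_rpow (by linarith) hl) (fun t ht => ?_) measurableSet_Ioi
      refine (hinner t ht).symm.trans (integral_congr_ae (.of_forall fun ω => ?_))
      exact (Real.norm_of_nonneg
        (mul_nonneg (Real.rpow_nonneg (mem_Ioi.1 ht).le _) (Real.exp_pos _).le)).symm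
  have houter : (fun ω => ∫ t in Ioi 0, f ω t) =ᵐ[μ] fun ω => Z ω ^ (-s) * Real.Gamma s := by
    filter_upwards [hZ.ae_pos hl] with ω hω
    have := Real.integral_rpow_mul_exp_neg_mul_Ioi hs hω
    rw [one_div, Real.inv_rpow hω.le, ← Real.rpow_neg hω.le] at this
    rw [← this]
    simp only [hf, neg_mul, mul_comm (Z ω)]
  have hint : Integrable (fun ω => Z ω ^ (-s) * Real.Gamma s) μ :=
    hprod.integral_prod_left.congr houter
  refine ⟨(integrable_mul_const_iff hΓ.isUnit _).1 hint, ?_⟩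
  have hswap := integral_integral_swap hprod
  rw [integral_congr_ae houter, integral_mul_const,
    setIntegral_congr_fun measurableSet_Ioi hinner,
    integral_rpow_mul_exp_neg_rpow hl (by linarith)] at hswap
  rw [add_comm 1 (s / l), add_comm 1 s, Real.Gamma_add_one (div_pos hs hl).ne',
    Real.Gamma_add_one hs.ne', eq_div_iff (mul_ne_zero hs.ne' hΓ)]
  rw [sub_add_cancel] at hswap
  calc _ = s * ((∫ ω, Z ω ^ (-s) ∂μ) * Real.Gamma s) := by ring
    _ = _ := by rw [hswap]; ring

lemma exp_mul_neg_log_ae_eq (hl : 0 < l) (hZ : IsPosStable μ Z l) (s : ℝ) :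
    (fun ω => Real.exp (s * -Real.log (Z ω))) =ᵐ[μ] fun ω => Z ω ^ (-s) := by
  filter_upwards [hZ.ae_pos hl] with ω hω
  rw [Real.rpow_def_of_pos hω]
  ring_nf

lemma hasDerivWithinAt_mgf_neg_log (hl : 0 < l) (hZ : IsPosStable μ Z l) :
    HasDerivWithinAt (mgf (fun ω => -Real.log (Z ω)) μ)
      (Real.eulerMascheroniConstant - Real.eulerMascheroniConstant / l) (Ioi 0) 0 := by
  have hnum : HasDerivAt (fun s : ℝ => Real.Gamma (1 + s / l))
      (-Real.eulerMascheroniConstant * (1 / l)) 0 := by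
    refine HasDerivAt.comp (h₂ := Real.Gamma) 0 ?_ (((hasDerivAt_id 0).div_const l).const_add 1)
    simpa using Real.hasDerivAt_Gamma_one
  have hden : HasDerivAt (fun s : ℝ => Real.Gamma (1 + s)) (-Real.eulerMascheroniConstant) 0 := by
    have h1 : HasDerivAt Real.Gamma (-Real.eulerMascheroniConstant) (1 + 0) := by
      simpa using Real.hasDerivAt_Gamma_one
    exact h1.comp_const_add 1 0
  have hquot := hnum.div hden (by simp)
  refine (hquot.congr_deriv ?_).hasDerivWithinAt.congr (fun s hs => ?_) (by simp)
  · simp only [add_zero, zero_div, Real.Gamma_one]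
    ring
  rw [mgf, integral_congr_ae (hZ.exp_mul_neg_log_ae_eq hl s),
    (hZ.integrable_and_integral_rpow_neg hl hs).2, Pi.div_apply]

end IsPosStable

end

/-- Expectation of `η = l · log Z` for `Z` positive stable with parameter `l`:
`E[η] = (1 - l) γ` where `γ` is the Euler–Mascheroni constant. -/
theorem stmt_4 {Ω : Type*} [MeasurableSpace Ω] (μ : Measure Ω) [IsProbabilityMeasure μ]
    (l : ℝ) (hl0 : 0 < l) (hl1 : l ≤ 1)
    (Z : Ω → ℝ) (hZ : IsPosStable μ Z l) :
    Integrable (fun ω => l * Real.log (Z ω)) μ ∧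
      ∫ ω, l * Real.log (Z ω) ∂μ = (1 - l) * Real.eulerMascheroniConstant := by
  obtain ⟨hint, hval⟩ := integrable_and_integral_eq_of_hasDerivWithinAt_mgf
    (fun s hs _ => (hZ.integrable_and_integral_rpow_neg hl0 hs).1.congr
      (hZ.exp_mul_neg_log_ae_eq hl0 s).symm) (hZ.hasDerivWithinAt_mgf_neg_log hl0)
  rw [integral_neg] at hval
  refine ⟨(integrable_neg_iff.1 hint).const_mul l, ?_⟩
  rw [integral_const_mul, neg_eq_iff_eq_neg.1 hval]
  field_simp
  ring
end
end

section
/- Let N be a nonempty finite index set of nests, for each n ∈ N let 𝒩ₙ be a nonempty finite set of alternatives (pairwise disjoint), λₙ ∈ (0,1], and let (U_j) be real numbers. Let (ε̃_j) be a random vector with the nested logit distribution with nests {𝒩ₙ} and parameters (λₙ). Then for each nest n and each j ∈ 𝒩ₙ, the probability that j maximizes utility, P( U_j + ε̃_j ≥ U_{j'} + ε̃_{j'} for all j' ), equals [ (Σ_{j'∈𝒩ₙ} e^{U_{j'}/λₙ})^{λₙ} / Σ_{n'∈N} (Σ_{j'∈𝒩_{n'}} e^{U_{j'}/λ_{n'}})^{λ_{n'}}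 ] · [ e^{U_j/λₙ} / Σ_{j'∈𝒩ₙ} e^{U_{j'}/λₙ} ]. -/
open MeasureTheory ProbabilityTheory Real

noncomputable section

/-- If the joint cdf is `exp (-G)` with `G` homogeneous under translations, then decrements of
`G` in one coordinate bound from below the probability that this coordinate is the strict maximum. -/
theorem sub_le_measureReal_isStrictMax {Ω ι : Type*} [MeasurableSpace Ω] [Fintype ι]
    [DecidableEq ι] (μ : Measure Ω) [IsProbabilityMeasure μ] (X : ι → Ω → ℝ)
    (hX : ∀ i, Measurable (X i)) (G : (ι → ℝ) → ℝ)
    (hcdf : ∀ a, μ.real {ω | ∀ i, X i ω ≤ a i} = exp (-G a))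
    (hG : ∀ a t, G (fun i => a i + t) = exp (-t) * G a) (hG0 : 0 < G 0)
    (i : ι) {h : ℝ} (hh : 0 < h) :
    G 0 - G (Pi.single i h) ≤
      μ.real {ω | ∀ k, k ≠ i → X k ω < X i ω} * (G 0 * (exp h - 1)) := by
  have hle : ∀ a : ι → ℝ, MeasurableSet {ω | ∀ k, X k ω ≤ a k} := fun a => by
    simp only [Set.ofPred_forall]
    exact MeasurableSet.iInter fun k => measurableSet_le (hX k) measurable_const
  have heh : 0 < exp h - 1 := by linarith [add_one_lt_exp hh.ne']
  have hq : 0 ≤ G 0 - G (Pi.single i h) := by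
    have : exp (-G 0) ≤ exp (-G (Pi.single i h)) := by
      rw [← hcdf, ← hcdf]
      refine measureReal_mono fun ω hω k => (hω k).trans ?_
      exact (Pi.single_nonneg.2 hh.le : (0 : ι → ℝ) ≤ Pi.single i h) k
    linarith [exp_le_exp.1 this]
  set q := G 0 - G (Pi.single i h) with hq_def
  set g := G 0 with hg_def
  set c := q / (g * (exp h - 1)) with hc_def
  have hc : 0 ≤ c := by positivity
  have hterm : ∀ y : ℝ, 0 < y →
      c * (exp (-(y * g)) - exp (-(y * exp h * g)))
        ≤ exp (-(y * G (Pi.single i h))) - exp (-(y * g)) := by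
    intro y hy
    have h1 : exp (-(y * G (Pi.single i h))) = exp (-(y * g)) * exp (y * q) := by
      rw [← exp_add]; congr 1; rw [hq_def]; ring
    have h2 : exp (-(y * exp h * g)) = exp (-(y * g)) * exp (-(y * (exp h - 1) * g)) := by
      rw [← exp_add]; congr 1; ring
    have h3 := add_one_le_exp (y * q)
    have h4 := add_one_le_exp (-(y * (exp h - 1) * g))
    calc c * (exp (-(y * g)) - exp (-(y * exp h * g)))
        = c * (exp (-(y * g)) * (1 - exp (-(y * (exp h - 1) * g)))) := by rw [h2]; ring
      _ ≤ c * (exp (-(y * g)) * (y * (exp h - 1) * g)) := by gcongr; linarith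
      _ = exp (-(y * g)) * (y * q) := by rw [hc_def]; field_simp
      _ ≤ exp (-(y * g)) * (exp (y * q) - 1) := by gcongr; linarith
      _ = _ := by rw [h1]; ring
  have hgrid : ∀ K : ℕ,
      c * (exp (-(exp (-((K - 1) * h)) * g)) - exp (-(exp ((K + 1) * h) * g))) ≤
        μ.real {ω | ∀ k, k ≠ i → X k ω < X i ω} := by
    intro K
    let x : ℕ → ℝ := fun m => ((m : ℝ) - K) * h
    have hx : ∀ m, x (m + 1) = x m + h := fun m => by simp only [x]; push_cast; ring
    have hxmono : Monotone x := monotone_nat_of_le_succ fun m => by rw [hx]; linarith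
    let B : ℕ → Set Ω := fun m => {ω | ∀ k, X k ω ≤ Pi.single (M := fun _ => ℝ) i h k + x m}
    let A : ℕ → Set Ω := fun m => {ω | ∀ k, X k ω ≤ (0 : ι → ℝ) k + x m}
    have hAB : ∀ m, A m ⊆ B m := fun m ω hω k => (hω k).trans <| by
      gcongr
      exact (Pi.single_nonneg.2 hh.le : (0 : ι → ℝ) ≤ Pi.single i h) k
    have hother : ∀ m, ∀ ω ∈ B m, ∀ k, k ≠ i → X k ω ≤ x m := fun m ω hω k hk => by
      simpa [hk] using hω k
    have hi : ∀ m, ∀ ω ∈ B m \ A m, x m < X i ω := fun m ω hω => by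
      by_contra! hcon
      refine hω.2 fun k => ?_
      rcases eq_or_ne k i with rfl | hk
      · simpa using hcon
      · simpa using hother m ω hω.1 k hk
    have hi' : ∀ m, ∀ ω ∈ B m, X i ω ≤ x (m + 1) := fun m ω hω => by
      simpa [hx, add_comm] using hω i
    have hdisj : ∀ m m', m < m' → Disjoint (B m \ A m) (B m' \ A m') := fun m m' hm =>
      Set.disjoint_left.2 fun ω h1 h2 => by
        linarith [hi' m ω h1.1, hi m' ω h2, hxmono (Nat.succ_le_of_lt hm)]
    have hcell : ∀ m, μ.real (B m \ A m) =
        exp (-(exp (-x m) * G (Pi.single i h))) - exp (-(exp (-x m) * g)) := fun m => by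
      rw [measureReal_sdiff (hAB m) (hle _), hcdf, hcdf, hG, hG]
    let f : ℕ → ℝ := fun m => exp (-(exp (-(x m - h)) * g))
    have hf : ∀ m, c * (f (m + 1) - f m) ≤ μ.real (B m \ A m) := fun m => by
      have hsucc : f (m + 1) = exp (-(exp (-x m) * g)) := by
        simp only [f, hx, add_sub_cancel_right]
      have hcur : f m = exp (-(exp (-x m) * exp h * g)) := by
        simp only [f]
        rw [← exp_add, neg_sub, sub_eq_neg_add]
      rw [hcell, hsucc, hcur]
      exact hterm (exp (-x m)) (exp_pos _)
    calc c * (exp (-(exp (-((K - 1) * h)) * g)) - exp (-(exp ((K + 1) * h) * g)))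
        = c * (f (2 * K) - f 0) := by
          simp only [f, x]; congr 6 <;> push_cast <;> ring
      _ = ∑ m ∈ Finset.range (2 * K), c * (f (m + 1) - f m) := by
          rw [← Finset.mul_sum, Finset.sum_range_sub]
      _ ≤ ∑ m ∈ Finset.range (2 * K), μ.real (B m \ A m) := Finset.sum_le_sum fun m _ => hf m
      _ = μ.real (⋃ m ∈ Finset.range (2 * K), B m \ A m) := by
          rw [measureReal_biUnion_finset]
          · intro m _ m' _ hm
            rcases hm.lt_or_gt with hm | hm
            · exact hdisj _ _ hm
            · exact (hdisj _ _ hm).symm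
          · exact fun m _ => (hle _).diff (hle _)
      _ ≤ _ := by
          refine measureReal_mono fun ω hω k hk => ?_
          simp only [Set.mem_iUnion] at hω
          obtain ⟨m, _, hω⟩ := hω
          exact (hother m ω hω.1 k hk).trans_lt (hi m ω hω)
  have hlim : Filter.Tendsto (fun K : ℕ =>
      c * (exp (-(exp (-((K - 1) * h)) * g)) - exp (-(exp ((K + 1) * h) * g))))
      Filter.atTop (nhds (c * (exp (-(0 * g)) - 0))) := by
    have hK := tendsto_natCast_atTop_atTop (R := ℝ)
    refine ((Filter.Tendsto.sub ?_ ?_).const_mul c)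
    · refine (continuous_exp.tendsto _).comp (Filter.Tendsto.neg (Filter.Tendsto.mul_const g ?_))
      refine tendsto_exp_neg_atTop_nhds_zero.comp (Filter.Tendsto.atTop_mul_const hh ?_)
      simpa [sub_eq_add_neg] using Filter.tendsto_atTop_add_const_right _ (-1 : ℝ) hK
    · refine tendsto_exp_neg_atTop_nhds_zero.comp (Filter.Tendsto.atTop_mul_const hG0 ?_)
      refine tendsto_exp_atTop.comp (Filter.Tendsto.atTop_mul_const hh ?_)
      exact Filter.tendsto_atTop_add_const_right _ (1 : ℝ) hK
  have hcP := le_of_tendsto' hlim hgrid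
  rw [zero_mul, neg_zero, exp_zero, sub_zero, mul_one, hc_def, div_le_iff₀ (by positivity)] at hcP
  exact hcP

/-- Choice probabilities of a generalized extreme value model: if the joint cdf is `exp (-G)` with
`G` homogeneous under translations, the probability that coordinate `i` is the maximum is the
logarithmic derivative of `G` at `0` in direction `i`, up to sign. -/
theorem measureReal_isMax_of_cdf {Ω ι : Type*} [MeasurableSpace Ω] [Fintype ι]
    [DecidableEq ι] (μ : Measure Ω) [IsProbabilityMeasure μ] (X : ι → Ω → ℝ)
    (hX : ∀ i, Measurable (X i)) (G : (ι → ℝ) → ℝ)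
    (hcdf : ∀ a, μ.real {ω | ∀ i, X i ω ≤ a i} = exp (-G a))
    (hG : ∀ a t, G (fun i => a i + t) = exp (-t) * G a) (hG0 : 0 < G 0) (D : ι → ℝ)
    (hD : ∀ i, HasDerivAt (fun h => G (Pi.single i h)) (-D i) 0) (hsum : ∑ i, D i = G 0)
    (i : ι) :
    μ.real {ω | ∀ k, X k ω ≤ X i ω} = D i / G 0 := by
  let S : ι → Set Ω := fun i => {ω | ∀ k, k ≠ i → X k ω < X i ω}
  have hSm : ∀ i, MeasurableSet (S i) := fun i => by
    simp only [S, Set.ofPred_forall]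
    exact MeasurableSet.iInter fun k => MeasurableSet.iInter fun _ =>
      measurableSet_lt (hX k) (hX i)
  have hlow : ∀ i, D i / G 0 ≤ μ.real (S i) := fun i => by
    have hd : HasDerivAt (fun h => μ.real (S i) * (G 0 * (exp h - 1)) + G (Pi.single i h))
        (μ.real (S i) * (G 0 * exp 0) + -D i) 0 :=
      ((((hasDerivAt_exp 0).sub_const 1).const_mul (G 0)).const_mul _).add (hD i)
    have := ge_of_tendsto (b := 0) hd.tendsto_slope_zero_right <| by
      filter_upwards [self_mem_nhdsWithin] with h (hh : 0 < h)
      have := sub_le_measureReal_isStrictMax μ X hX G hcdf hG hG0 i hh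
      simp only [zero_add, exp_zero, sub_self, mul_zero, Pi.single_zero, smul_eq_mul]
      refine mul_nonneg (by positivity) ?_
      simp only [S]
      linarith
    rw [exp_zero, mul_one] at this
    rw [div_le_iff₀ hG0]
    linarith
  have hdisj : Pairwise (Function.onFun Disjoint S) := fun a b hab =>
    Set.disjoint_left.2 fun ω ha hb => (ha b hab.symm).asymm (hb a hab)
  have hone : ∑ i, D i / G 0 = 1 := by rw [← Finset.sum_div, hsum, div_self hG0.ne']
  refine le_antisymm ?_ ((hlow i).trans ?_)
  · have hU : μ.real {ω | ∀ k, X k ω ≤ X i ω} + ∑ k ∈ Finset.univ.erase i, μ.real (S k) ≤ 1 := by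
      rw [← measureReal_biUnion_finset (fun a _ b _ hab => hdisj hab) (fun k _ => hSm k),
        ← measureReal_union ?_ (Finset.measurableSet_biUnion _ fun k _ => hSm k)
          (measure_ne_top μ _) (measure_ne_top μ _)]
      · exact measureReal_le_one
      · refine Set.disjoint_left.2 fun ω h1 h2 => ?_
        simp only [Set.mem_iUnion] at h2
        obtain ⟨k, hk, h2⟩ := h2
        exact (h2 i (Finset.ne_of_mem_erase hk).symm).not_ge (h1 k)
    have := Finset.sum_le_sum fun k (_ : k ∈ Finset.univ.erase i) => hlow k
    have := Finset.add_sum_erase Finset.univ (fun i => D i / G 0) (Finset.mem_univ i)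
    linarith
  · refine measureReal_mono fun ω hω k => ?_
    rcases eq_or_ne k i with rfl | hk
    · exact le_rfl
    · exact (hω k hk).le

/-- Nested logit choice probabilities: if `(ε̃_j)` has the nested logit distribution, the
probability that alternative `j` in nest `n` maximizes utility is the product of the nest
choice probability and the within-nest conditional choice probability. -/
theorem stmt_11 {Ω : Type*} [MeasurableSpace Ω] (μ : Measure Ω) [IsProbabilityMeasure μ]
    {N : Type*} [Fintype N] [Nonempty N]
    (J : N → Type*) [∀ n, Fintype (J n)] [∀ n, Nonempty (J n)]
    (lam : N → ℝ) (hlam : ∀ n, lam n ∈ Set.Ioc (0 : ℝ) 1)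
    (U : (Σ n, J n) → ℝ)
    (ε : (Σ n, J n) → Ω → ℝ) (hmeas : ∀ j, Measurable (ε j))
    (hcdf : ∀ a : (Σ n, J n) → ℝ,
      μ {ω | ∀ j : Σ n, J n, ε j ω ≤ a j}
        = ENNReal.ofReal (Real.exp
            (-(∑ n, (∑ j : J n, Real.exp (-a ⟨n, j⟩ / lam n)) ^ lam n))))
    (n : N) (j : J n) :
    (μ {ω | ∀ j' : Σ n, J n, U j' + ε j' ω ≤ U ⟨n, j⟩ + ε ⟨n, j⟩ ω}).toReal
      = ((∑ j' : J n, Real.exp (U ⟨n, j'⟩ / lam n)) ^ lam n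
            / ∑ n', (∑ j' : J n', Real.exp (U ⟨n', j'⟩ / lam n')) ^ lam n')
        * (Real.exp (U ⟨n, j⟩ / lam n) / ∑ j' : J n, Real.exp (U ⟨n, j'⟩ / lam n)) := by
  classical
  have hpos : ∀ n, 0 < lam n := fun n => (hlam n).1
  let G : ((Σ n, J n) → ℝ) → ℝ := fun a =>
    ∑ n, (∑ j : J n, exp ((U ⟨n, j⟩ - a ⟨n, j⟩) / lam n)) ^ lam n
  have hS : ∀ n, 0 < ∑ j : J n, exp (U ⟨n, j⟩ / lam n) := fun n =>
    Finset.sum_pos (fun j _ => exp_pos _) Finset.univ_nonempty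
  have hG0 : G 0 = ∑ n, (∑ j : J n, exp (U ⟨n, j⟩ / lam n)) ^ lam n := by simp [G]
  let D : (Σ n, J n) → ℝ := fun p =>
    (∑ j : J p.1, exp (U ⟨p.1, j⟩ / lam p.1)) ^ lam p.1 *
      (exp (U p / lam p.1) / ∑ j : J p.1, exp (U ⟨p.1, j⟩ / lam p.1))
  have key := measureReal_isMax_of_cdf μ (fun p ω => U p + ε p ω)
    (fun p => (hmeas p).const_add _) G ?_ ?_ ?_ D ?_ ?_ ⟨n, j⟩
  · rw [measureReal_def] at key
    rw [key, hG0]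
    simp only [D]
    ring
  · intro a
    have := hcdf fun p => a p - U p
    simp only [le_sub_iff_add_le', neg_sub] at this
    rw [measureReal_def, this, ENNReal.toReal_ofReal (exp_pos _).le]
  · intro a t
    simp only [G, Finset.mul_sum]
    refine Finset.sum_congr rfl fun n _ => ?_
    have : ∀ j : J n, exp ((U ⟨n, j⟩ - (a ⟨n, j⟩ + t)) / lam n) =
        exp (-t / lam n) * exp ((U ⟨n, j⟩ - a ⟨n, j⟩) / lam n) := fun j => by
      rw [← exp_add]; congr 1; ring
    simp only [this]
    rw [← Finset.mul_sum, mul_rpow (exp_pos _).le (Finset.sum_nonneg fun j _ => (exp_pos _).le),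
      ← exp_mul, div_mul_cancel₀ _ (hpos n).ne']
  · rw [hG0]
    exact Finset.sum_pos (fun n _ => rpow_pos_of_pos (hS n) _) Finset.univ_nonempty
  · rintro ⟨n₀, j₀⟩
    have hcoord : ∀ p : Σ n, J n, HasDerivAt
        (fun h : ℝ => Pi.single (M := fun _ => ℝ) (⟨n₀, j₀⟩ : Σ n, J n) h p)
        (Pi.single (M := fun _ => ℝ) (⟨n₀, j₀⟩ : Σ n, J n) 1 p) 0 := fun p => by
      rcases eq_or_ne p ⟨n₀, j₀⟩ with rfl | hp
      · simpa using hasDerivAt_id' (0 : ℝ)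
      · simpa [hp] using hasDerivAt_const (0 : ℝ) (0 : ℝ)
    have hd := HasDerivAt.fun_sum (u := Finset.univ) fun n (_ : n ∈ Finset.univ) =>
      (HasDerivAt.fun_sum (u := Finset.univ) fun j (_ : j ∈ Finset.univ) =>
        (((hcoord ⟨n, j⟩).const_sub (U ⟨n, j⟩)).div_const (lam n)).exp).rpow_const
          (p := lam n) (Or.inl (by simpa using (hS n).ne'))
    refine hd.congr_deriv ?_
    rw [Finset.sum_eq_single n₀, Finset.sum_eq_single j₀]
    · have := (hpos n₀).ne'
      have := (hS n₀).ne'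
      simp only [Pi.single_zero, Pi.zero_apply, sub_zero, Pi.single_eq_same, D]
      rw [rpow_sub_one this]
      field_simp
    · intro j _ hj
      simp [hj]
    · simp
    · intro n _ hn
      simp [hn]
    · simp
  · rw [hG0, Fintype.sum_sigma]
    refine Finset.sum_congr rfl fun n _ => ?_
    change ∑ j : J n, (∑ j : J n, exp (U ⟨n, j⟩ / lam n)) ^ lam n *
      (exp (U ⟨n, j⟩ / lam n) / ∑ j : J n, exp (U ⟨n, j⟩ / lam n)) = _
    rw [← Finset.mul_sum, ← Finset.sum_div, div_self (hS n).ne', mul_one]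
end
end

section
/- Fix N ∈ ℕ with N ≥ 1, nest parameters λₙ ∈ (0,1] for n ∈ N nests with pairwise disjoint nonempty finite alternative sets 𝒩ₙ, and real numbers (U_j). Define G : ℝ^{⋃ₙ𝒩ₙ} → ℝ by G(U) = log Σ_{n∈N} (Σ_{j∈𝒩ₙ} exp(U_j/λₙ))^{λₙ}. Then for each nest n and each j ∈ 𝒩ₙ, the partial derivative of G with respect to the coordinate U_j exists and equals [ (Σ_{j'∈𝒩ₙ} e^{U_{j'}/λₙ})^{λₙ} / Σ_{n'∈N} (Σ_{j'∈𝒩_{n'}} e^{U_{j'}/λ_{n'}})^{λ_{n'}} ] · [ e^{U_j/λₙ} / Σ_{j'∈𝒩ₙ} e^{U_{j'}/λₙ} ]. -/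
open MeasureTheory ProbabilityTheory Real

noncomputable section

/-- Daly–Zachary–Williams for the single-layer nested logit: the partial derivative of the
Emax function `G(U) = log ∑_n (∑_{j∈𝒩_n} exp (U_j/λ_n))^{λ_n}` with respect to the coordinate
`U_j`, `j ∈ 𝒩_n`, equals the nested logit choice probability of `j`. -/
theorem stmt_13 {N : Type*} [Fintype N] [Nonempty N]
    (J : N → Type*) [∀ n, Fintype (J n)] [∀ n, Nonempty (J n)]
    [DecidableEq (Σ n, J n)]
    (lam : N → ℝ) (hlam : ∀ n, lam n ∈ Set.Ioc (0 : ℝ) 1)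
    (U : (Σ n, J n) → ℝ) (n : N) (j : J n) :
    HasDerivAt
      (fun t : ℝ => Real.log (∑ n', (∑ j' : J n',
          Real.exp (Function.update U ⟨n, j⟩ t ⟨n', j'⟩ / lam n')) ^ lam n'))
      (((∑ j' : J n, Real.exp (U ⟨n, j'⟩ / lam n)) ^ lam n
          / ∑ n', (∑ j' : J n', Real.exp (U ⟨n', j'⟩ / lam n')) ^ lam n')
        * (Real.exp (U ⟨n, j⟩ / lam n) / ∑ j' : J n, Real.exp (U ⟨n, j'⟩ / lam n)))
      (U ⟨n, j⟩) := by
  have hS : ∀ m, 0 < ∑ k : J m, Real.exp (U ⟨m, k⟩ / lam m) := fun m =>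
    Finset.sum_pos (fun _ _ => Real.exp_pos _) Finset.univ_nonempty
  have hT : 0 < ∑ m, (∑ k : J m, Real.exp (U ⟨m, k⟩ / lam m)) ^ lam m :=
    Finset.sum_pos (fun m _ => Real.rpow_pos_of_pos (hS m) _) Finset.univ_nonempty
  have hcoord := hasDerivAt_pi.1 (hasDerivAt_update U (⟨n, j⟩ : Σ n, J n) (U ⟨n, j⟩))
  have hsum : ∀ m, HasDerivAt
      (fun t : ℝ => ∑ k : J m, Real.exp (Function.update U ⟨n, j⟩ t ⟨m, k⟩ / lam m))
      (∑ k : J m, Real.exp (U ⟨m, k⟩ / lam m)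
        * ((Pi.single ⟨n, j⟩ 1 : (Σ n, J n) → ℝ) ⟨m, k⟩ / lam m)) (U ⟨n, j⟩) := by
    intro m
    refine HasDerivAt.fun_sum fun k _ => ?_
    simpa only [Function.update_eq_self] using ((hcoord ⟨m, k⟩).div_const (lam m)).exp
  have hpow := HasDerivAt.fun_sum (u := Finset.univ) fun m _ =>
    (hsum m).rpow_const (p := lam m)
      (Or.inl (by simpa only [Function.update_eq_self] using (hS m).ne'))
  have hlog := hpow.log (by simpa only [Function.update_eq_self] using hT.ne')
  simp only [Function.update_eq_self] at hlog
  have hother : ∀ m, m ≠ n → ∑ k : J m, Real.exp (U ⟨m, k⟩ / lam m)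
      * ((Pi.single ⟨n, j⟩ 1 : (Σ n, J n) → ℝ) ⟨m, k⟩ / lam m) = 0 := by
    intro m hm
    refine Finset.sum_eq_zero fun k _ => ?_
    rw [Pi.single_eq_of_ne (fun h => hm (congrArg Sigma.fst h))]
    simp
  have hsame : ∑ k : J n, Real.exp (U ⟨n, k⟩ / lam n)
      * ((Pi.single ⟨n, j⟩ 1 : (Σ n, J n) → ℝ) ⟨n, k⟩ / lam n)
      = Real.exp (U ⟨n, j⟩ / lam n) / lam n := by
    rw [Finset.sum_eq_single j]
    · rw [Pi.single_eq_same, mul_one_div]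
    · intro k _ hk
      rw [Pi.single_eq_of_ne (fun h => hk (sigma_mk_injective h))]
      simp
    · simp
  rw [Finset.sum_eq_single (M := ℝ) (f := fun m => (∑ k : J m, Real.exp (U ⟨m, k⟩ / lam m)
      * ((Pi.single ⟨n, j⟩ 1 : (Σ n, J n) → ℝ) ⟨m, k⟩ / lam m)) * lam m
      * (∑ k : J m, Real.exp (U ⟨m, k⟩ / lam m)) ^ (lam m - 1)) n
      (fun m _ hm => by rw [hother m hm]; simp) (by simp), hsame,
    Real.rpow_sub_one (hS n).ne'] at hlog
  convert hlog using 1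
  have key : ∀ P T e S l : ℝ, l ≠ 0 → P / T * (e / S) = e / l * l * (P / S) / T := by
    intro P T e S l hl
    rw [div_mul_cancel₀ e hl]
    ring
  exact key _ _ _ _ _ (hlam n).1.ne'
end
end
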